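/- Let a, b be non-negative integers and let k be a positive odd integer. Then in U_q^-(gl_∞): (1) for odd ℓ > k, ⟨−k⟩⟨−k+2,ℓ⟩^{(a)}⟨−k,ℓ⟩^{(b)} = [b+1]⟨−k+2,ℓ⟩^{(a−1)}⟨−k,ℓ⟩^{(b+1)} + q^{a−b}⟨−k+2,ℓ⟩^{(a)}⟨−k,ℓ⟩^{(b)}⟨−k⟩; (2) ⟨−k⟩⟨−k+2,k⟩^{(a)}⟨−k,k⟩^{[b]} = [2b+2]⟨−k+2,k⟩^{(a−1)}⟨−k,k⟩^{[b+1]} + q^{a−b}⟨−k+2,k⟩^{(a)}⟨−k,k⟩^{[b]}⟨−k⟩; (3) for k > 1, ⟨−k⟩⟨−k+2,k−2⟩^{[a]} = (q^a+q^{−a})^{−1}⟨−k+2,k−2⟩^{[a−1]}⟨−k,k−2⟩ + q^a⟨−k+2,k−2⟩^{[a]}⟨−k⟩; (4) for odd ℓ ≤ k−2, ⟨ℓ,k−2⟩^{(a)}⟨k⟩ = ⟨ℓ,k⟩⟨ℓ,k−2⟩^{(a−1)} + q^a⟨k⟩⟨ℓ,k−2⟩^{(a)}; (5) for k > 1, ⟨−k+2,k−2⟩^{[a]}⟨k⟩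 = (q^a+q^{−a})^{−1}⟨−k+2,k⟩⟨−k+2,k−2⟩^{[a−1]} + q^a⟨k⟩⟨−k+2,k−2⟩^{[a]}. -/

import Mathlib

/-! Basic setup: `K = ℚ(q)` and the algebra `U_q^-(gl_∞)`. -/

noncomputable section

/-- The base field `K = ℚ(q)`. -/
abbrev K : Type := RatFunc ℚ

/-- The indeterminate `q`. -/
def q : K := RatFunc.X

/-- The `q`-integer `[n]`. -/
def qint (n : ℤ) : K := (q ^ n - q ^ (-n)) / (q - q⁻¹)

/-- The `q`-factorial `[n]!`. -/
def qfact (n : ℕ) : K := ∏ k ∈ Finset.range n, qint (k + 1)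

/-- The `q`-Serre relations defining `U_q^-(gl_∞)`; the generator indexed by `a : ℤ`
corresponds to `f_i` for the odd integer `i = 2a+1`, so that `|i - j| > 2 ↔ 1 < |a - b|`
and `|i - j| = 2 ↔ |a - b| = 1`. -/
inductive URel : FreeAlgebra K ℤ → FreeAlgebra K ℤ → Prop
  | far (a b : ℤ) (h : 1 < |a - b|) :
      URel (FreeAlgebra.ι K a * FreeAlgebra.ι K b) (FreeAlgebra.ι K b * FreeAlgebra.ι K a)
  | serre (a b : ℤ) (h : |a - b| = 1) :
      URel (FreeAlgebra.ι K a * FreeAlgebra.ι K a * FreeAlgebra.ι K b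
            + FreeAlgebra.ι K b * (FreeAlgebra.ι K a * FreeAlgebra.ι K a))
           ((q + q⁻¹) • (FreeAlgebra.ι K a * FreeAlgebra.ι K b * FreeAlgebra.ι K a))

/-- The algebra `U_q^-(gl_∞)`. -/
abbrev U : Type := RingQuot URel

/-- The generator `f_i` of `U_q^-(gl_∞)`, for an odd integer `i`. -/
def fgen (i : ℤ) : U := RingQuot.mkAlgHom K URel (FreeAlgebra.ι K ((i - 1) / 2))

/-- `segAux i n` is the segment `⟨i, i+2n⟩`. -/
def segAux (i : ℤ) : ℕ → U
  | 0 => fgen i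
  | n + 1 => segAux i n * fgen (i + 2 * (n + 1)) - q • (fgen (i + 2 * (n + 1)) * segAux i n)

/-- The segment `⟨i,j⟩ ∈ U_q^-(gl_∞)` for odd `i ≤ j`. -/
def seg (i j : ℤ) : U := segAux i ((j - i) / 2).toNat

/-- The divided power `⟨i,j⟩^{(n)}` (zero for `n < 0`). -/
def segPow (i j : ℤ) (n : ℤ) : U :=
  if n < 0 then 0 else (qfact n.toNat)⁻¹ • seg i j ^ n.toNat

/-- The modified divided power `⟨i,j⟩^{[n]}`. -/
def segPowM (i j : ℤ) (n : ℤ) : U :=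
  if i = -j then
    (if n < 0 then 0 else (∏ ν ∈ Finset.range n.toNat, qint (2 * (ν + 1)))⁻¹ • seg i j ^ n.toNat)
  else segPow i j n


theorem q_ne_zero : q ≠ 0 := RatFunc.X_ne_zero

theorem q_pow_ne_one {n : ℕ} (hn : n ≠ 0) : q ^ n ≠ 1 := by
  intro h
  have h1 : algebraMap (Polynomial ℚ) K (Polynomial.X ^ n) = algebraMap (Polynomial ℚ) K 1 := by
    simpa [q, RatFunc.algebraMap_X] using h
  have h2 := congrArg Polynomial.natDegree (RatFunc.algebraMap_injective ℚ h1)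
  simp at h2
  exact hn h2

theorem q_zpow_sub_zpow_neg_ne_zero {n : ℕ} (hn : n ≠ 0) :
    q ^ (n : ℤ) - q ^ (-(n : ℤ)) ≠ 0 := by
  intro h
  refine q_pow_ne_one (n := n + n) (by omega) ?_
  have hq : q ^ n ≠ 0 := pow_ne_zero _ q_ne_zero
  rw [zpow_neg, zpow_natCast, sub_eq_zero] at h
  rw [pow_add]
  nth_rewrite 1 [h]
  exact inv_mul_cancel₀ hq

theorem q_sub_inv_ne_zero : q - q⁻¹ ≠ 0 := by
  simpa using q_zpow_sub_zpow_neg_ne_zero one_ne_zero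

theorem q_sq_add_one_ne_zero : q ^ 2 + 1 ≠ 0 := by
  intro h
  refine q_pow_ne_one (n := 4) (by norm_num) ?_
  linear_combination (q ^ 2 - 1) * h

theorem qint_ne_zero {n : ℕ} (hn : n ≠ 0) : qint n ≠ 0 :=
  div_ne_zero (q_zpow_sub_zpow_neg_ne_zero hn) q_sub_inv_ne_zero

theorem qint_one : qint 1 = 1 := by
  simpa [qint] using div_self q_sub_inv_ne_zero

theorem qint_add_one (n : ℤ) : qint (n + 1) = q⁻¹ * qint n + q ^ n := by
  have h := q_sub_inv_ne_zero
  have hq := q_ne_zero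
  rw [qint, qint, eq_comm, ← mul_div_assoc, div_add' _ _ _ h, neg_add, zpow_add₀ hq, zpow_add₀ hq,
    zpow_one, zpow_neg_one]
  ring

theorem qint_two_mul (n : ℤ) : qint (2 * n) = qint n * (q ^ n + q ^ (-n)) := by
  have hq := q_ne_zero
  rw [qint, qint, div_mul_eq_mul_div, two_mul, neg_add, zpow_add₀ hq, zpow_add₀ hq]
  ring

section Algebra

variable {F A : Type*} [Field F] [Ring A] [Algebra F A] {t : F}

/-- The `t`-commutator `xy - t yx`. -/
def qbracket (t : F) (x y : A) : A := x * y - t • (y * x)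

/-- The quantum Serre relations of type `A₂` between `x` and `y`, expressed by the
`t`-commutation of `x` and `y` with their `t`-commutator. -/
structure SerrePair (t : F) (x y : A) : Prop where
  left : x * qbracket t x y = t⁻¹ • (qbracket t x y * x)
  right : qbracket t x y * y = t⁻¹ • (y * qbracket t x y)

theorem SerrePair.of_serre (ht : t ≠ 0) {x y : A}
    (h₁ : x * x * y + y * (x * x) = (t + t⁻¹) • (x * y * x))
    (h₂ : y * y * x + x * (y * y) = (t + t⁻¹) • (y * x * y)) : SerrePair t x y := by
  simp only [mul_assoc] at h₁ h₂
  constructor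
  · simp only [qbracket, mul_sub, sub_mul, smul_mul_assoc, mul_smul_comm, mul_assoc, smul_sub,
      smul_smul, inv_mul_cancel₀ ht, one_smul]
    linear_combination (norm := module) h₁
  · simp only [qbracket, mul_sub, sub_mul, smul_mul_assoc, mul_smul_comm, mul_assoc, smul_sub,
      smul_smul, inv_mul_cancel₀ ht, one_smul]
    linear_combination (norm := module) h₂

theorem SerrePair.serre_left (ht : t ≠ 0) {x y : A} (h : SerrePair t x y) :
    x * (x * y) + y * (x * x) = (t + t⁻¹) • (x * (y * x)) := by
  have h₁ := h.left
  simp only [qbracket, mul_sub, sub_mul, smul_mul_assoc, mul_smul_comm, mul_assoc, smul_sub,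
      smul_smul, inv_mul_cancel₀ ht, one_smul] at h₁
  linear_combination (norm := module) h₁

theorem SerrePair.serre_right (ht : t ≠ 0) {x y : A} (h : SerrePair t x y) :
    x * (y * y) + y * (y * x) = (t + t⁻¹) • (y * (x * y)) := by
  have h₁ := h.right
  simp only [qbracket, mul_sub, sub_mul, smul_mul_assoc, mul_smul_comm, mul_assoc, smul_sub,
      smul_smul, inv_mul_cancel₀ ht, one_smul] at h₁
  linear_combination (norm := module) h₁

theorem qbracket_assoc {x z : A} (y : A) (h : Commute x z) :
    qbracket t (qbracket t x y) z = qbracket t x (qbracket t y z) := by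
  have h₁ : x * (z * y) = z * (x * y) := by rw [← mul_assoc, h.eq, mul_assoc]
  simp only [qbracket, mul_sub, sub_mul, smul_mul_assoc, mul_smul_comm, mul_assoc, smul_sub,
    smul_smul, h₁, h.eq]
  module

/-- In type `A₃` the middle generator commutes with the root vector of the highest root. -/
theorem commute_qbracket_qbracket (ht : t ≠ 0) (ht2 : t ^ 2 + 1 ≠ 0) {x y z : A}
    (hxy : SerrePair t x y) (hyz : SerrePair t y z) (hxz : Commute x z) :
    Commute y (qbracket t (qbracket t x y) z) := by
  have e₁ : z * (x * (y * y)) = x * (z * (y * y)) := by rw [← mul_assoc, ← hxz.eq, mul_assoc]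
  have e₂ : z * (x * y) = x * (z * y) := by rw [← mul_assoc z, ← hxz.eq, mul_assoc]
  have s₁ := congrArg (· * z) (hxy.serre_right ht)
  have s₂ := congrArg (· * x) (hyz.serre_left ht)
  have s₃ := congrArg (x * ·) (hyz.serre_left ht)
  have s₄ := congrArg (z * ·) (hxy.serre_right ht)
  simp only [mul_add, add_mul, smul_mul_assoc, mul_smul_comm, mul_assoc, e₁, hxz.eq]
    at s₁ s₂ s₃ s₄
  change _ * _ = _ * _
  simp only [qbracket, mul_sub, sub_mul, smul_mul_assoc, mul_smul_comm, mul_assoc, smul_sub,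
    smul_smul, e₂, hxz.eq]
  linear_combination (norm := skip) (t / (t ^ 2 + 1)) • (s₃ - s₁) +
    (t ^ 3 / (t ^ 2 + 1)) • (s₄ - s₂)
  match_scalars <;> field_simp <;> ring

theorem qbracket_mul {x y w : A} {c : F} (hy : Commute y w) (hx : x * w = c • (w * x)) :
    qbracket t x y * w = c • (w * qbracket t x y) := by
  have h₁ : x * (y * w) = c • (w * (x * y)) := by
    rw [hy.eq, ← mul_assoc, hx, smul_mul_assoc, mul_assoc]
  have h₂ : y * (x * w) = c • (w * (y * x)) := by
    rw [hx, mul_smul_comm, ← mul_assoc, hy.eq, mul_assoc]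
  simp only [qbracket, mul_sub, sub_mul, smul_mul_assoc, mul_smul_comm, mul_assoc, h₁, h₂]
  module

theorem mul_qbracket {x y w : A} {c : F} (hx : Commute w x) (hy : w * y = c • (y * w)) :
    w * qbracket t x y = c • (qbracket t x y * w) := by
  have h₁ : w * (x * y) = c • (x * (y * w)) := by
    rw [← mul_assoc, hx.eq, mul_assoc, hy, mul_smul_comm]
  have h₂ : w * (y * x) = c • (y * (x * w)) := by
    rw [← mul_assoc, hy, smul_mul_assoc, mul_assoc, hx.eq]
  simp only [qbracket, mul_sub, sub_mul, smul_mul_assoc, mul_smul_comm, mul_assoc, h₁, h₂]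
  module

theorem SerrePair.mul_qbracket_qbracket {x y z : A} (hxy : SerrePair t x y)
    (hxz : Commute x z) : x * qbracket t (qbracket t x y) z =
      t⁻¹ • (qbracket t (qbracket t x y) z * x) := by
  have h₁ : x * (z * qbracket t x y) = t⁻¹ • (z * (qbracket t x y * x)) := by
    rw [← mul_assoc, hxz.eq, mul_assoc, hxy.left, mul_smul_comm]
  have h₂ : x * (qbracket t x y * z) = t⁻¹ • (qbracket t x y * (z * x)) := by
    rw [← mul_assoc, hxy.left, smul_mul_assoc, mul_assoc, hxz.eq]
  rw [qbracket, mul_sub, mul_smul_comm, h₁, h₂, sub_mul, smul_mul_assoc, mul_assoc, mul_assoc]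
  module

theorem SerrePair.qbracket_qbracket_mul {x y z : A} (hyz : SerrePair t y z)
    (hxz : Commute x z) : qbracket t x (qbracket t y z) * z =
      t⁻¹ • (z * qbracket t x (qbracket t y z)) := by
  have h₁ : x * (qbracket t y z * z) = t⁻¹ • (z * (x * qbracket t y z)) := by
    rw [hyz.right, mul_smul_comm, ← mul_assoc, hxz.eq, mul_assoc]
  have h₂ : qbracket t y z * (x * z) = t⁻¹ • (z * (qbracket t y z * x)) := by
    rw [hxz.eq, ← mul_assoc, hyz.right, smul_mul_assoc, mul_assoc]
  rw [qbracket, sub_mul, smul_mul_assoc, mul_assoc, mul_assoc, h₁, h₂, mul_sub, mul_smul_comm]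
  module

theorem SerrePair.qbracket_left (ht : t ≠ 0) (ht2 : t ^ 2 + 1 ≠ 0) {x y z : A}
    (hxy : SerrePair t x y) (hyz : SerrePair t y z) (hxz : Commute x z) :
    SerrePair t (qbracket t x y) z where
  left := qbracket_mul (commute_qbracket_qbracket ht ht2 hxy hyz hxz)
    (hxy.mul_qbracket_qbracket hxz)
  right := by
    rw [qbracket_assoc y hxz]
    exact hyz.qbracket_qbracket_mul hxz

theorem SerrePair.qbracket_right (ht : t ≠ 0) (ht2 : t ^ 2 + 1 ≠ 0) {x y z : A}
    (hxy : SerrePair t x y) (hyz : SerrePair t y z) (hxz : Commute x z) :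
    SerrePair t x (qbracket t y z) where
  left := by
    rw [← qbracket_assoc y hxz]
    exact hxy.mul_qbracket_qbracket hxz
  right := by
    rw [← qbracket_assoc y hxz]
    exact mul_qbracket (commute_qbracket_qbracket ht ht2 hxy hyz hxz).symm
      (by rw [qbracket_assoc y hxz]; exact hyz.qbracket_qbracket_mul hxz)

theorem mul_pow_qcomm {x z : A} {c : F} (h : x * z = c • (z * x)) (n : ℕ) :
    x * z ^ n = c ^ n • (z ^ n * x) := by
  induction n with
  | zero => simp
  | succ n ih =>
    rw [pow_succ, ← mul_assoc, ih, smul_mul_assoc, mul_assoc, h, mul_smul_comm, smul_smul,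
      ← pow_succ, mul_assoc]

theorem SerrePair.mul_pow {x y : A} (h : SerrePair t x y) {c : ℕ → F} (h₁ : c 1 = 1)
    (hc : ∀ n, c (n + 1) = t⁻¹ * c n + t ^ n) (n : ℕ) :
    x * y ^ (n + 1) = c (n + 1) • (y ^ n * qbracket t x y) + t ^ (n + 1) • (y ^ (n + 1) * x) := by
  have hxy : x * y = qbracket t x y + t • (y * x) := by simp [qbracket]
  induction n with
  | zero => simp [h₁, hxy]
  | succ n ih =>
    rw [pow_succ y (n + 1), ← mul_assoc, ih, add_mul, smul_mul_assoc, smul_mul_assoc, mul_assoc,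
      h.right, mul_assoc _ x, hxy, hc (n + 1), mul_add, mul_smul_comm, mul_smul_comm, ← mul_assoc,
      ← pow_succ, ← mul_assoc, ← pow_succ, pow_succ t (n + 1)]
    module

theorem SerrePair.pow_mul {x y : A} (h : SerrePair t x y) {c : ℕ → F} (h₁ : c 1 = 1)
    (hc : ∀ n, c (n + 1) = t⁻¹ * c n + t ^ n) (n : ℕ) :
    x ^ (n + 1) * y = c (n + 1) • (qbracket t x y * x ^ n) + t ^ (n + 1) • (y * x ^ (n + 1)) := by
  have hxy : x * y = qbracket t x y + t • (y * x) := by simp [qbracket]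
  induction n with
  | zero => simp [h₁, hxy]
  | succ n ih =>
    rw [pow_succ' x (n + 1), mul_assoc, ih, mul_add, mul_smul_comm, mul_smul_comm, ← mul_assoc,
      h.left, ← mul_assoc x y, hxy, hc (n + 1), add_mul, smul_mul_assoc, smul_mul_assoc, mul_assoc,
      ← pow_succ', mul_assoc, ← pow_succ', pow_succ t (n + 1)]
    module

end Algebra

section DividedPowers

variable {A : Type*} [Ring A] [Algebra K A] {x y : A} {d : ℤ → K}

/-- The power `y ^ n` divided by `d 1 * ⋯ * d n`, and zero for `n < 0`. -/
def divPow (d : ℤ → K) (y : A) (n : ℤ) : A :=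
  if n < 0 then 0 else (∏ ν ∈ Finset.range n.toNat, d (ν + 1))⁻¹ • y ^ n.toNat

theorem divPow_natCast (d : ℤ → K) (y : A) (n : ℕ) :
    divPow d y n = (∏ ν ∈ Finset.range n, d (ν + 1))⁻¹ • y ^ n := by
  simp [divPow]

theorem mul_divPow_self {n : ℕ} (hd : d (n + 1) ≠ 0) :
    y * divPow d y n = d (n + 1) • divPow d y (n + 1) := by
  have h := divPow_natCast d y (n + 1)
  rw [Nat.cast_succ] at h
  rw [h, divPow_natCast, Finset.prod_range_succ, mul_inv, smul_smul, mul_smul_comm, ← pow_succ',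
    mul_comm, mul_assoc, inv_mul_cancel₀ hd, mul_one]

theorem SerrePair.mul_divPow (h : SerrePair q x y) {n : ℕ} {c : K}
    (hc : n ≠ 0 → qint n / d n = c) :
    x * divPow d y n = c • (divPow d y ((n : ℤ) - 1) * qbracket q x y) +
      q ^ (n : ℤ) • (divPow d y n * x) := by
  cases n with
  | zero => simp [divPow]
  | succ n =>
    rw [← hc n.succ_ne_zero, Nat.cast_add_one, add_sub_cancel_right, ← Nat.cast_add_one,
      divPow_natCast, divPow_natCast, mul_smul_comm,
      h.mul_pow (c := fun n => qint n) (by simp [qint_one])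
      (fun n => by simpa using qint_add_one n), Finset.prod_range_succ, zpow_natCast, mul_inv,
      Nat.cast_add_one, div_eq_mul_inv, smul_mul_assoc, smul_mul_assoc]
    simp only [smul_add, smul_smul]
    congr 2 <;> ring

theorem SerrePair.divPow_mul (h : SerrePair q x y) {n : ℕ} {c : K}
    (hc : n ≠ 0 → qint n / d n = c) :
    divPow d x n * y = c • (qbracket q x y * divPow d x ((n : ℤ) - 1)) +
      q ^ (n : ℤ) • (y * divPow d x n) := by
  cases n with
  | zero => simp [divPow]
  | succ n =>
    rw [← hc n.succ_ne_zero, Nat.cast_add_one, add_sub_cancel_right, ← Nat.cast_add_one,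
      divPow_natCast, divPow_natCast, smul_mul_assoc,
      h.pow_mul (c := fun n => qint n) (by simp [qint_one])
      (fun n => by simpa using qint_add_one n), Finset.prod_range_succ, zpow_natCast, mul_inv,
      Nat.cast_add_one, div_eq_mul_inv, mul_smul_comm, mul_smul_comm]
    simp only [smul_add, smul_smul]
    congr 2 <;> ring

theorem SerrePair.mul_divPow_qbracket (h : SerrePair q x y) (n : ℕ) :
    x * divPow d (qbracket q x y) n =
      q ^ (-(n : ℤ)) • (divPow d (qbracket q x y) n * x) := by
  rw [divPow_natCast, mul_smul_comm, mul_pow_qcomm h.left, smul_mul_assoc, smul_comm, inv_pow,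
    zpow_neg, zpow_natCast]

theorem SerrePair.mul_divPow_mul_divPow (h : SerrePair q x y) (a : ℕ) {b : ℕ}
    (hd : d (b + 1) ≠ 0) :
    x * divPow qint y a * divPow d (qbracket q x y) b =
      d (b + 1) • (divPow qint y ((a : ℤ) - 1) * divPow d (qbracket q x y) ((b : ℤ) + 1)) +
      q ^ ((a : ℤ) - b) • (divPow qint y a * divPow d (qbracket q x y) b * x) := by
  rw [h.mul_divPow (c := 1) fun ha => div_self (qint_ne_zero ha), one_smul, add_mul, mul_assoc,
    mul_divPow_self hd, mul_smul_comm, smul_mul_assoc, mul_assoc _ x, h.mul_divPow_qbracket,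
    mul_smul_comm, smul_smul, ← zpow_add₀ q_ne_zero, ← mul_assoc, ← sub_eq_add_neg]

end DividedPowers

theorem qint_div_qint_two_mul {n : ℕ} (hn : n ≠ 0) :
    qint n / qint (2 * n) = (q ^ (n : ℤ) + q ^ (-(n : ℤ)))⁻¹ := by
  rw [qint_two_mul, div_mul_cancel_left₀ (qint_ne_zero hn)]

theorem commute_fgen (i : ℤ) {m : ℕ} (hm : 2 ≤ m) : Commute (fgen i) (fgen (i + 2 * m)) := by
  have h := RingQuot.mkAlgHom_rel K (URel.far ((i - 1) / 2) ((i + 2 * m - 1) / 2)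
    (by rw [lt_abs]; omega))
  rwa [map_mul, map_mul] at h

theorem serrePair_fgen (i : ℤ) : SerrePair q (fgen i) (fgen (i + 2)) := by
  have h₁ := RingQuot.mkAlgHom_rel K (URel.serre ((i - 1) / 2) ((i + 2 - 1) / 2)
    (by rw [abs_eq (by norm_num)]; omega))
  have h₂ := RingQuot.mkAlgHom_rel K (URel.serre ((i + 2 - 1) / 2) ((i - 1) / 2)
    (by rw [abs_eq (by norm_num)]; omega))
  simp only [map_add, map_mul, map_smul] at h₁ h₂
  exact .of_serre q_ne_zero h₁ h₂

theorem segAux_succ (i : ℤ) (n : ℕ) :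
    segAux i (n + 1) = qbracket q (segAux i n) (fgen (i + 2 * (n + 1))) := rfl

theorem Commute.qbracket_right {A : Type*} [Ring A] [Algebra K A] {w x y : A} (c : K)
    (hx : Commute w x) (hy : Commute w y) : Commute w (qbracket c x y) :=
  (hx.mul_right hy).sub_right ((hy.mul_right hx).smul_right c)

theorem commute_fgen_segAux (i : ℤ) {m : ℕ} (hm : 2 ≤ m) (n : ℕ) :
    Commute (fgen i) (segAux (i + 2 * m) n) := by
  induction n with
  | zero => exact commute_fgen i hm
  | succ n ih =>
    rw [segAux_succ]
    refine ih.qbracket_right q ?_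
    rw [show i + 2 * m + 2 * ((n : ℤ) + 1) = i + 2 * (m + (n + 1) : ℕ) by push_cast; ring]
    exact commute_fgen i (by omega)

theorem commute_segAux_fgen (i : ℤ) (n : ℕ) {m : ℕ} (hm : n + 2 ≤ m) :
    Commute (segAux i n) (fgen (i + 2 * m)) := by
  induction n with
  | zero => exact commute_fgen i hm
  | succ n ih =>
    rw [segAux_succ]
    refine ((ih (by omega)).symm.qbracket_right q ?_).symm
    rw [show i + 2 * (m : ℤ) = i + 2 * (n + 1) + 2 * (m - (n + 1) : ℕ) by omega]
    exact (commute_fgen _ (by omega)).symm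

theorem serrePair_segAux_fgen (i : ℤ) (n : ℕ) :
    SerrePair q (segAux i n) (fgen (i + 2 * (n + 1))) := by
  induction n with
  | zero => simpa [segAux] using serrePair_fgen i
  | succ n ih =>
    rw [segAux_succ]
    refine ih.qbracket_left q_ne_zero q_sq_add_one_ne_zero ?_ ?_
    · convert serrePair_fgen (i + 2 * (n + 1)) using 2
      push_cast
      ring
    · exact_mod_cast commute_segAux_fgen i n (m := n + 2) le_rfl

theorem segAux_succ' (i : ℤ) (n : ℕ) :
    segAux i (n + 1) = qbracket q (fgen i) (segAux (i + 2) n) := by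
  induction n with
  | zero => simp [segAux, qbracket]
  | succ n ih =>
    have h : Commute (fgen i) (fgen (i + 2 * ((n + 1 : ℕ) + 1))) := by
      exact_mod_cast commute_fgen i (m := n + 2) (by omega)
    rw [segAux_succ, ih, qbracket_assoc _ h, segAux_succ (i + 2)]
    congr 3
    push_cast
    ring

theorem serrePair_fgen_segAux (i : ℤ) (n : ℕ) :
    SerrePair q (fgen i) (segAux (i + 2) n) := by
  induction n generalizing i with
  | zero => exact serrePair_fgen i
  | succ n ih =>
    rw [segAux_succ']
    refine (serrePair_fgen i).qbracket_right q_ne_zero q_sq_add_one_ne_zero (ih (i + 2)) ?_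
    rw [show i + 2 + 2 = i + 2 * (2 : ℕ) by push_cast; ring]
    exact commute_fgen_segAux i le_rfl n

theorem seg_self (i : ℤ) : seg i i = fgen i := by
  simp [seg, segAux]

theorem seg_add_two_mul (i : ℤ) (n : ℕ) : seg i (i + 2 * n) = segAux i n := by
  rw [seg]
  congr 1
  omega

theorem exists_eq_add_two_mul {i j : ℤ} (hi : Odd i) (hj : Odd j) (hij : i ≤ j) :
    ∃ n : ℕ, j = i + 2 * n := by
  obtain ⟨r, rfl⟩ := hi
  obtain ⟨s, rfl⟩ := hj
  exact ⟨(s - r).toNat, by omega⟩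

theorem serrePair_seg_left {i j : ℤ} (hi : Odd i) (hj : Odd j) (hij : i < j) :
    SerrePair q (seg i i) (seg (i + 2) j) ∧ qbracket q (seg i i) (seg (i + 2) j) = seg i j := by
  have hi2 : Odd (i + 2) := hi.add_even even_two
  obtain ⟨n, rfl⟩ := exists_eq_add_two_mul hi2 hj (by grind)
  have h := seg_add_two_mul i (n + 1)
  rw [show i + 2 * ((n + 1 : ℕ) : ℤ) = i + 2 + 2 * n by push_cast; ring] at h
  rw [h, seg_add_two_mul, seg_self, segAux_succ']
  exact ⟨serrePair_fgen_segAux i n, rfl⟩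

theorem serrePair_seg_right {i j : ℤ} (hi : Odd i) (hj : Odd j) (hij : i < j) :
    SerrePair q (seg i (j - 2)) (seg j j) ∧ qbracket q (seg i (j - 2)) (seg j j) = seg i j := by
  have hj2 : Odd (j - 2) := hj.sub_even even_two
  obtain ⟨n, hn⟩ := exists_eq_add_two_mul hi hj2 (by grind)
  obtain rfl : j = i + 2 * ((n + 1 : ℕ) : ℤ) := by omega
  rw [hn, seg_add_two_mul, seg_add_two_mul, seg_self, segAux_succ, Nat.cast_succ]
  exact ⟨serrePair_segAux_fgen i n, rfl⟩

theorem segPow_eq_divPow (i j n : ℤ) : segPow i j n = divPow qint (seg i j) n := rfl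

theorem segPowM_eq_divPow {i j : ℤ} (h : i = -j) (n : ℤ) :
    segPowM i j n = divPow (fun m => qint (2 * m)) (seg i j) n := if_pos h


/-- Lemma 3.18 of Enomoto–Kashiwara. Here `a b : ℕ` and `k` is a positive odd integer. -/
theorem divided_power_commutation_relations (a b : ℕ) (k : ℤ) (hk : Odd k) (hkpos : 0 < k) :
    (∀ l : ℤ, Odd l → k < l →
      seg (-k) (-k) * segPow (-k + 2) l a * segPow (-k) l b =
        qint (b + 1) • (segPow (-k + 2) l ((a : ℤ) - 1) * segPow (-k) l ((b : ℤ) + 1)) +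
        q ^ ((a : ℤ) - b) • (segPow (-k + 2) l a * segPow (-k) l b * seg (-k) (-k))) ∧
    (seg (-k) (-k) * segPow (-k + 2) k a * segPowM (-k) k b =
        qint (2 * b + 2) • (segPow (-k + 2) k ((a : ℤ) - 1) * segPowM (-k) k ((b : ℤ) + 1)) +
        q ^ ((a : ℤ) - b) • (segPow (-k + 2) k a * segPowM (-k) k b * seg (-k) (-k))) ∧
    (1 < k →
      seg (-k) (-k) * segPowM (-k + 2) (k - 2) a =
        (q ^ (a : ℤ) + q ^ (-(a : ℤ)))⁻¹ •
          (segPowM (-k + 2) (k - 2) ((a : ℤ) - 1) * seg (-k) (k - 2)) +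
        q ^ (a : ℤ) • (segPowM (-k + 2) (k - 2) a * seg (-k) (-k))) ∧
    (∀ l : ℤ, Odd l → l ≤ k - 2 →
      segPow l (k - 2) a * seg k k =
        seg l k * segPow l (k - 2) ((a : ℤ) - 1) +
        q ^ (a : ℤ) • (seg k k * segPow l (k - 2) a)) ∧
    (1 < k →
      segPowM (-k + 2) (k - 2) a * seg k k =
        (q ^ (a : ℤ) + q ^ (-(a : ℤ)))⁻¹ •
          (seg (-k + 2) k * segPowM (-k + 2) (k - 2) ((a : ℤ) - 1)) +
        q ^ (a : ℤ) • (seg k k * segPowM (-k + 2) (k - 2) a)) := by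
  have hk' : Odd (-k) := hk.neg
  have hd (b : ℕ) : qint (2 * ((b : ℤ) + 1)) ≠ 0 := by
    exact_mod_cast qint_ne_zero (n := 2 * (b + 1)) (by omega)
  refine ⟨fun l hl hkl => ?_, ?_, fun hk1 => ?_, fun l hl hlk => ?_, fun hk1 => ?_⟩
  · obtain ⟨hs, he⟩ := serrePair_seg_left hk' hl (by omega)
    simp only [segPow_eq_divPow, ← he]
    exact hs.mul_divPow_mul_divPow a (by exact_mod_cast qint_ne_zero b.succ_ne_zero)
  · obtain ⟨hs, he⟩ := serrePair_seg_left hk' hk (by omega)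
    simp only [segPow_eq_divPow, segPowM_eq_divPow rfl, ← he]
    rw [hs.mul_divPow_mul_divPow (d := fun m => qint (2 * m)) a (hd b), mul_add, mul_one]
  · obtain ⟨hs, he⟩ := serrePair_seg_left (j := k - 2) hk' (hk.sub_even even_two) (by omega)
    simp only [segPowM_eq_divPow (show -k + 2 = -(k - 2) by ring), ← he]
    exact hs.mul_divPow qint_div_qint_two_mul
  · obtain ⟨hs, he⟩ := serrePair_seg_right hl hk (by omega)
    simp only [segPow_eq_divPow, ← he]
    rw [hs.divPow_mul (c := 1) fun ha => div_self (qint_ne_zero ha), one_smul]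
  · obtain ⟨hs, he⟩ := serrePair_seg_right (i := -k + 2) (hk'.add_even even_two) hk (by omega)
    simp only [segPowM_eq_divPow (show -k + 2 = -(k - 2) by ring), ← he]
    exact hs.divPow_mul qint_div_qint_two_mul

end
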